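/- Let A ∈ ℝ^{n×n}, B ∈ ℝ^{n×m}, γ ∈ (0,1], and let K*, K† ∈ ℝ^{m×n} be such that A_c* = A + B·K* and A_c† = A + B·K† are Schur stable. Let d*, d† ∈ ℝ^n and let h*, h† ∈ ℝ^n be the (unique) solutions of h* = d* + γ·(A_c*)ᵀ·h* and h† = d† + γ·(A_c†)ᵀ·h†. Suppose γ·‖B‖·‖K† − K*‖ ≤ 1/(2·‖(I − γ·(A_c*)ᵀ)^{-1}‖). Then ‖h† − h*‖ ≤ Γ₅·‖d† − d*‖ + Γ₆·‖K† − K*‖, where Γ₅ = 2·‖(I − γ·(A_c*)ᵀ)^{-1}‖ and Γ₆ = 2γ·‖(I − γ·(A_c*)ᵀ)^{-1}‖²·‖d*‖·‖B‖. -/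

import Mathlib

open Matrix

/-- The spectral norm (operator 2-norm) of a real matrix. -/
noncomputable def specNorm {m n : ℕ} (M : Matrix (Fin m) (Fin n) ℝ) : ℝ :=
  ‖LinearMap.toContinuousLinearMap (Matrix.toEuclideanLin M)‖

/-- The Euclidean norm of a real vector. -/
noncomputable def vecNorm {n : ℕ} (v : Fin n → ℝ) : ℝ :=
  ‖(EuclideanSpace.equiv (Fin n) ℝ).symm v‖

/-- A real square matrix is Schur stable if its spectral radius is less than one. -/
def SchurStable {n : ℕ} (M : Matrix (Fin n) (Fin n) ℝ) : Prop :=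
  spectralRadius ℂ (M.map Complex.ofReal) < 1

theorem specNorm_nonneg {m n : ℕ} (M : Matrix (Fin m) (Fin n) ℝ) : 0 ≤ specNorm M :=
  norm_nonneg _

open scoped Matrix.Norms.L2Operator in
theorem specNorm_mul_le {l m n : ℕ} (M : Matrix (Fin l) (Fin m) ℝ) (N : Matrix (Fin m) (Fin n) ℝ) :
    specNorm (M * N) ≤ specNorm M * specNorm N :=
  Matrix.l2_opNorm_mul M N

open scoped Matrix.Norms.L2Operator in
theorem specNorm_transpose {m n : ℕ} (M : Matrix (Fin m) (Fin n) ℝ) :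
    specNorm Mᵀ = specNorm M := by
  rw [← Matrix.conjTranspose_eq_transpose_of_trivial]
  exact Matrix.l2_opNorm_conjTranspose M

open scoped Matrix.Norms.L2Operator in
theorem vecNorm_mulVec_le {m n : ℕ} (M : Matrix (Fin m) (Fin n) ℝ) (v : Fin n → ℝ) :
    vecNorm (M.mulVec v) ≤ specNorm M * vecNorm v :=
  Matrix.l2_opNorm_mulVec M (WithLp.toLp 2 v)

theorem vecNorm_nonneg {n : ℕ} (v : Fin n → ℝ) : 0 ≤ vecNorm v :=
  norm_nonneg _

theorem vecNorm_add_le {n : ℕ} (v w : Fin n → ℝ) : vecNorm (v + w) ≤ vecNorm v + vecNorm w := by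
  unfold vecNorm
  rw [map_add]
  exact norm_add_le _ _

theorem vecNorm_smul {n : ℕ} {c : ℝ} (hc : 0 ≤ c) (v : Fin n → ℝ) :
    vecNorm (c • v) = c * vecNorm v := by
  unfold vecNorm
  rw [map_smul, norm_smul, Real.norm_of_nonneg hc]

theorem SchurStable.isUnit_det_one_sub_smul_transpose {n : ℕ} {M : Matrix (Fin n) (Fin n) ℝ}
    (hM : SchurStable M) {γ : ℝ} (hγ0 : 0 < γ) (hγ1 : γ ≤ 1) : IsUnit (1 - γ • Mᵀ).det := by
  rw [isUnit_iff_ne_zero]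
  intro hdet
  have hfactor : 1 - γ • Mᵀ = (γ • (algebraMap ℝ (Matrix (Fin n) (Fin n) ℝ) γ⁻¹ - M))ᵀ := by
    rw [Algebra.algebraMap_eq_smul_one, smul_sub, smul_inv_smul₀ hγ0.ne']
    simp
  have hdet' : (algebraMap ℝ (Matrix (Fin n) (Fin n) ℝ) γ⁻¹ - M).det = 0 := by
    rw [hfactor, Matrix.det_transpose, Matrix.det_smul] at hdet
    exact (mul_eq_zero.mp hdet).resolve_left (pow_ne_zero _ hγ0.ne')
  have hmem : ((γ⁻¹ : ℝ) : ℂ) ∈ spectrum ℂ (M.map Complex.ofReal) := by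
    rw [spectrum.mem_iff, Matrix.isUnit_iff_isUnit_det, isUnit_iff_ne_zero, not_not]
    have hmap : algebraMap ℂ (Matrix (Fin n) (Fin n) ℂ) ((γ⁻¹ : ℝ) : ℂ) - M.map Complex.ofReal =
        Complex.ofRealHom.mapMatrix (algebraMap ℝ (Matrix (Fin n) (Fin n) ℝ) γ⁻¹ - M) := by
      ext i j
      by_cases h : i = j <;> simp [Matrix.algebraMap_matrix_apply, h]
    rw [hmap, ← RingHom.map_det, hdet', map_zero]
  have hle : (‖((γ⁻¹ : ℝ) : ℂ)‖₊ : ENNReal) ≤ spectralRadius ℂ (M.map Complex.ofReal) :=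
    le_iSup₂ (f := fun (k : ℂ) (_ : k ∈ spectrum ℂ (M.map Complex.ofReal)) => (‖k‖₊ : ENNReal))
      _ hmem
  have hlt : ‖((γ⁻¹ : ℝ) : ℂ)‖₊ < 1 := by exact_mod_cast hle.trans_lt hM
  have hnorm : ‖((γ⁻¹ : ℝ) : ℂ)‖ < 1 := by exact_mod_cast hlt
  rw [Complex.norm_real, Real.norm_of_nonneg (inv_nonneg.mpr hγ0.le)] at hnorm
  exact absurd hnorm (not_lt.mpr ((one_le_inv₀ hγ0).mpr hγ1))

/-- Perturbation bound on the linear part `h` of the value function: if `A_c* = A + BK*` and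
`A_c† = A + BK†` are Schur stable, `h* = d* + γ(A_c*)ᵀh*`, `h† = d† + γ(A_c†)ᵀh†`, and
`γ‖B‖‖K† − K*‖ ≤ 1/(2‖(I − γ(A_c*)ᵀ)⁻¹‖)`, then
`‖h† − h*‖ ≤ Γ₅‖d† − d*‖ + Γ₆‖K† − K*‖`, with `Γ₅ = 2‖(I − γ(A_c*)ᵀ)⁻¹‖` and
`Γ₆ = 2γ‖(I − γ(A_c*)ᵀ)⁻¹‖²‖d*‖‖B‖`. -/
theorem linear_value_coeff_perturbation_bound {n m : ℕ}
    (A : Matrix (Fin n) (Fin n) ℝ) (B : Matrix (Fin n) (Fin m) ℝ)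
    (γ : ℝ) (hγ0 : 0 < γ) (hγ1 : γ ≤ 1)
    (Kstar Kdag : Matrix (Fin m) (Fin n) ℝ)
    (hstab₁ : SchurStable (A + B * Kstar)) (hstab₂ : SchurStable (A + B * Kdag))
    (dstar ddag hstar hdag : Fin n → ℝ)
    (hhstar : hstar = dstar + γ • ((A + B * Kstar)ᵀ.mulVec hstar))
    (hhdag : hdag = ddag + γ • ((A + B * Kdag)ᵀ.mulVec hdag))
    (hsmall : γ * specNorm B * specNorm (Kdag - Kstar) ≤
      1 / (2 * specNorm ((1 - γ • (A + B * Kstar)ᵀ)⁻¹))) :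
    vecNorm (hdag - hstar) ≤
      2 * specNorm ((1 - γ • (A + B * Kstar)ᵀ)⁻¹) * vecNorm (ddag - dstar) +
        2 * γ * specNorm ((1 - γ • (A + B * Kstar)ᵀ)⁻¹) ^ 2 * vecNorm dstar * specNorm B *
          specNorm (Kdag - Kstar) := by
  have hunit := hstab₁.isUnit_det_one_sub_smul_transpose hγ0 hγ1
  set G := (1 - γ • (A + B * Kstar)ᵀ)⁻¹ with hG
  have hstar_eq : hstar = G.mulVec dstar := by
    have hd : dstar = (1 - γ • (A + B * Kstar)ᵀ).mulVec hstar := by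
      rw [Matrix.sub_mulVec, Matrix.one_mulVec, Matrix.smul_mulVec]
      exact eq_sub_of_add_eq hhstar.symm
    rw [hd, Matrix.mulVec_mulVec, hG, Matrix.nonsing_inv_mul _ hunit, Matrix.one_mulVec]
  have hdiff_eq : hdag - hstar =
      G.mulVec ((ddag - dstar) + γ • (B * (Kdag - Kstar))ᵀ.mulVec hdag) := by
    have hK : (B * (Kdag - Kstar))ᵀ = (A + B * Kdag)ᵀ - (A + B * Kstar)ᵀ := by
      rw [← Matrix.transpose_sub, Matrix.mul_sub, add_sub_add_left_eq_sub]
    have hd : (ddag - dstar) + γ • (B * (Kdag - Kstar))ᵀ.mulVec hdag =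
        (1 - γ • (A + B * Kstar)ᵀ).mulVec (hdag - hstar) := by
      rw [hK, Matrix.sub_mulVec, Matrix.sub_mulVec, Matrix.one_mulVec, Matrix.smul_mulVec,
        Matrix.mulVec_sub, eq_sub_of_add_eq hhstar.symm, eq_sub_of_add_eq hhdag.symm,
        smul_sub, smul_sub]
      abel
    rw [hd, Matrix.mulVec_mulVec, hG, Matrix.nonsing_inv_mul _ hunit, Matrix.one_mulVec]
  have hhalf : specNorm G * (γ * specNorm B * specNorm (Kdag - Kstar)) ≤ 1 / 2 := by
    rcases (specNorm_nonneg G).eq_or_lt with h0 | hpos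
    · rw [← h0]
      norm_num
    · rw [le_div_iff₀ (by positivity)] at hsmall
      linarith
  have hstar_le : vecNorm hstar ≤ specNorm G * vecNorm dstar :=
    hstar_eq ▸ vecNorm_mulVec_le G dstar
  have hdag_le : vecNorm hdag ≤ vecNorm (hdag - hstar) + vecNorm hstar := by
    simpa using vecNorm_add_le (hdag - hstar) hstar
  have hG0 := specNorm_nonneg G
  have hB0 := specNorm_nonneg B
  have hK0 := specNorm_nonneg (Kdag - Kstar)
  have hdiff0 := vecNorm_nonneg (hdag - hstar)
  have hdiff_le : vecNorm (hdag - hstar) ≤ specNorm G * (vecNorm (ddag - dstar) +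
      γ * (specNorm B * specNorm (Kdag - Kstar) *
        (vecNorm (hdag - hstar) + specNorm G * vecNorm dstar))) := by
    calc vecNorm (hdag - hstar)
        ≤ specNorm G * vecNorm ((ddag - dstar) + γ • (B * (Kdag - Kstar))ᵀ.mulVec hdag) := by
          conv_lhs => rw [hdiff_eq]
          exact vecNorm_mulVec_le _ _
      _ ≤ specNorm G * (vecNorm (ddag - dstar) +
            γ * (specNorm (B * (Kdag - Kstar)) * vecNorm hdag)) := by
          gcongr
          refine (vecNorm_add_le _ _).trans ?_
          rw [vecNorm_smul hγ0.le, ← specNorm_transpose (B * (Kdag - Kstar))]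
          gcongr
          exact vecNorm_mulVec_le _ _
      _ ≤ _ := by
          have := vecNorm_nonneg hdag
          gcongr
          · exact specNorm_mul_le _ _
          · linarith
  linarith [mul_le_mul_of_nonneg_right hhalf hdiff0]
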